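/- Let (X,T) be a transitive topological dynamical system. Then (X,T) is disjoint from every minimal topological dynamical system if and only if (X,T) is weakly mixing and there exists a countable dense subset D of X such that for every nonempty open set U ⊆ X and every dynamical syndetic set B ⊆ ℤ₊ there is a point x ∈ D ∩ U (depending only on U and B) such that for every thick set A ⊆ ℤ₊ one has N_T(x,U) ∩ (A ∩ B) ≠ ∅. -/

import Mathlib

open Set Function Filter Topology

structure TDS where
  carrier : Type
  [ms : MetricSpace carrier]
  [cs : CompactSpace carrier]
  map : carrier → carrier
  cont : Continuous map
  surj : Function.Surjective map

attribute [instance] TDS.ms TDS.cs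

def orbit {X : Type*} (T : X → X) (x : X) : Set X :=
  Set.range fun n : ℕ => T^[n] x

def IsMinimalSys {Y : Type*} [TopologicalSpace Y] (S : Y → Y) : Prop :=
  ∀ y : Y, Dense (orbit S y)

def IsTransitiveSys {X : Type*} [TopologicalSpace X] (T : X → X) : Prop :=
  ∀ U V : Set X, IsOpen U → IsOpen V → U.Nonempty → V.Nonempty →
    {n : ℕ | (U ∩ T^[n] ⁻¹' V).Nonempty}.Infinite

def IsWeaklyMixingSys {X : Type*} [TopologicalSpace X] (T : X → X) : Prop :=
  IsTransitiveSys fun p : X × X => (T p.1, T p.2)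

def IsJoining {X Y : Type*} [TopologicalSpace X] [TopologicalSpace Y]
    (T : X → X) (S : Y → Y) (J : Set (X × Y)) : Prop :=
  J.Nonempty ∧ IsClosed J ∧ (∀ p ∈ J, (T p.1, S p.2) ∈ J) ∧
    Prod.fst '' J = Set.univ ∧ Prod.snd '' J = Set.univ

def DisjointSys {X Y : Type*} [TopologicalSpace X] [TopologicalSpace Y]
    (T : X → X) (S : Y → Y) : Prop :=
  ∀ J : Set (X × Y), IsJoining T S J → J = Set.univ

def Syndetic (A : Set ℕ) : Prop :=
  ∃ N : ℕ, ∀ i : ℕ, ∃ j ≤ N, i + j ∈ A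

def Thick (A : Set ℕ) : Prop :=
  ∀ L : ℕ, ∃ n : ℕ, ∀ j ≤ L, n + j ∈ A

def IsMinimalPoint {X : Type*} [TopologicalSpace X] (T : X → X) (x : X) : Prop :=
  ∀ y ∈ closure (orbit T x), closure (orbit T x) ⊆ closure (orbit T y)

def Proximal {X : Type*} [MetricSpace X] (T : X → X) (x y : X) : Prop :=
  ∃ u : ℕ → ℕ, Filter.Tendsto (fun i => dist (T^[u i] x) (T^[u i] y)) Filter.atTop (nhds 0)

def IsDistalPoint {X : Type*} [MetricSpace X] (T : X → X) (x : X) : Prop :=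
  ∀ y ∈ closure (orbit T x), Proximal T x y → y = x

def DynSyndetic (B : Set ℕ) : Prop :=
  ∃ 𝒴 : TDS, IsMinimalSys 𝒴.map ∧
    ∃ (y : 𝒴.carrier) (V : Set 𝒴.carrier),
      IsOpen V ∧ y ∈ V ∧ {n : ℕ | 𝒴.map^[n] y ∈ V} ⊆ B

def CentralSet (S : Set ℕ) : Prop :=
  ∃ 𝒵 : TDS, ∃ (z w : 𝒵.carrier) (W : Set 𝒵.carrier),
    IsMinimalPoint 𝒵.map w ∧ Proximal 𝒵.map z w ∧ IsOpen W ∧ w ∈ W ∧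
    {n : ℕ | 𝒵.map^[n] z ∈ W} ⊆ S

def CStarSet (A : Set ℕ) : Prop :=
  ∀ S : Set ℕ, CentralSet S → (A ∩ S).Nonempty


/-- Every window length occurs inside `A` starting at a syndetic set of positions. -/
def ThicklySyndetic (A : Set ℕ) : Prop :=
  ∀ L : ℕ, ∃ N : ℕ, ∀ a : ℕ, ∃ n, a ≤ n ∧ n ≤ a + N ∧ ∀ j ≤ L, n + j ∈ A

/-- The word `w`, written from position `a` on, has all its `true` letters in `A`. -/
def SitsIn (A : Set ℕ) (w : List Bool) (a : ℕ) : Prop :=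
  ∀ i, w[i]? = some true → a + i ∈ A

theorem SitsIn.append {A : Set ℕ} {u v : List Bool} {a : ℕ} (hu : SitsIn A u a)
    (hv : SitsIn A v (a + u.length)) : SitsIn A (u ++ v) a := by
  intro i hi
  rw [List.getElem?_append] at hi
  split_ifs at hi with h
  · exact hu i hi
  · have := hv _ hi
    rwa [show a + u.length + (i - u.length) = a + i by omega] at this

/-- The words obtained by concatenating finitely many words of `G`. -/
def concatenations (G : Set (List Bool)) : Set (List Bool) :=
  {v | ∃ l : List (List Bool), (∀ g ∈ l, g ∈ G) ∧ l.flatten = v}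

theorem nil_mem_concatenations (G : Set (List Bool)) : [] ∈ concatenations G :=
  ⟨[], by simp, rfl⟩

theorem subset_concatenations (G : Set (List Bool)) : G ⊆ concatenations G :=
  fun g hg => ⟨[g], by simpa using hg, by simp⟩

theorem append_mem_concatenations {G : Set (List Bool)} {u v : List Bool}
    (hu : u ∈ concatenations G) (hv : v ∈ concatenations G) : u ++ v ∈ concatenations G := by
  obtain ⟨l, hl, rfl⟩ := hu
  obtain ⟨l', hl', rfl⟩ := hv
  refine ⟨l ++ l', fun g hg => ?_, by simp⟩
  rcases List.mem_append.1 hg with h | h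
  exacts [hl g h, hl' g h]

/-- The word `w` occurs in `v` at position `j`. -/
def OccursAt (w v : List Bool) (j : ℕ) : Prop :=
  ∀ r < w.length, v[j + r]? = w[r]?

theorem OccursAt.append_right {w v : List Bool} {j : ℕ} (h : OccursAt w v j) (v' : List Bool) :
    OccursAt w (v ++ v') j := by
  intro r hr
  have h1 := h r hr
  have h2 : j + r < v.length := by
    rw [List.getElem?_eq_getElem hr] at h1
    exact (List.getElem?_eq_some_iff.1 h1).1
  rw [List.getElem?_append_left h2, h1]

theorem OccursAt.append_left {w v : List Bool} {j : ℕ} (h : OccursAt w v j) (v' : List Bool) :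
    OccursAt w (v' ++ v) (v'.length + j) := by
  intro r hr
  rw [List.getElem?_append_right (by omega), ← h r hr]
  congr 1
  omega

theorem List.IsSuffix.occursAt {w v : List Bool} (h : w <:+ v) :
    OccursAt w v (v.length - w.length) := by
  obtain ⟨u, rfl⟩ := h
  intro r hr
  rw [List.getElem?_append_right (by simp)]
  congr 1
  simp

theorem exists_occursAt_le {w : List Bool} {R : ℕ} {v : List Bool}
    (hv : v ∈ concatenations {g | w <:+ g ∧ g.length ≤ R}) (hne : v ≠ []) :
    ∃ j ≤ R, OccursAt w v j := by
  obtain ⟨l, hl, rfl⟩ := hv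
  cases l with
  | nil => simp at hne
  | cons g l =>
    obtain ⟨h1, h2⟩ := hl g (by simp)
    refine ⟨g.length - w.length, by omega, ?_⟩
    rw [List.flatten_cons]
    exact h1.occursAt.append_right _

theorem exists_occursAt_of_add_le {w : List Bool} {R : ℕ} {v : List Bool}
    (hv : v ∈ concatenations {g | w <:+ g ∧ g.length ≤ R}) (i : ℕ) (hi : i + w.length < v.length) :
    ∃ j ≤ 2 * R, OccursAt w v (i + j) := by
  obtain ⟨l, hl, rfl⟩ := hv
  induction l generalizing i with
  | nil => simp at hi
  | cons g l ih =>
    rw [List.flatten_cons] at hi ⊢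
    rw [List.length_append] at hi
    have hg := hl g (by simp)
    have hl' : ∀ g ∈ l, g ∈ {g | w <:+ g ∧ g.length ≤ R} := fun g hg => hl g (by simp [hg])
    have hlen := hg.1.length_le
    have hgR := hg.2
    by_cases h1 : g.length ≤ i
    · obtain ⟨j, hj, h⟩ := ih (i - g.length) hl' (by omega)
      refine ⟨j, hj, ?_⟩
      have := h.append_left g
      rwa [show g.length + (i - g.length + j) = i + j by omega] at this
    · by_cases h2 : i ≤ g.length - w.length
      · refine ⟨g.length - w.length - i, by omega, ?_⟩
        rw [show i + (g.length - w.length - i) = g.length - w.length by omega]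
        exact hg.1.occursAt.append_right _
      · have hne : l.flatten ≠ [] := by
          intro h
          rw [h] at hi
          simp at hi
          omega
        obtain ⟨j, hj, h⟩ := exists_occursAt_le ⟨l, hl', rfl⟩ hne
        refine ⟨g.length - i + j, by omega, ?_⟩
        have := h.append_left g
        rwa [show g.length + j = i + (g.length - i + j) by omega] at this

/-- A prefix `w` of the sequence under construction, together with a monoid `M` of words
all further prefixes are taken from. -/
structure RecurrenceStage (A : Set ℕ) where
  w : List Bool
  M : Set (List Bool)
  nil_mem : [] ∈ M
  append_mem : ∀ u ∈ M, ∀ v ∈ M, u ++ v ∈ M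
  w_mem : w ∈ M
  sits : SitsIn A w 0
  runs : ∃ R : ℕ, ∀ a : ℕ, ∃ u ∈ M, u ≠ [] ∧ u.length ≤ R ∧ SitsIn A u a

theorem RecurrenceStage.exists_next {A : Set ℕ} (hA : ThicklySyndetic A) (σ : RecurrenceStage A) :
    ∃ τ : RecurrenceStage A, σ.w <+: τ.w ∧ σ.w.length < τ.w.length ∧ τ.M ⊆ σ.M ∧
      ∃ R : ℕ, τ.M ⊆ concatenations {g | τ.w <:+ g ∧ g.length ≤ R} := by
  obtain ⟨R, hR⟩ := σ.runs
  have reach : ∀ a d : ℕ, ∃ u ∈ σ.M, d ≤ u.length ∧ u.length ≤ d + R ∧ SitsIn A u a := by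
    intro a d
    induction d with
    | zero => exact ⟨[], σ.nil_mem, by simp, by simp, fun i hi => by simp at hi⟩
    | succ d ih =>
      obtain ⟨u, hu, h1, h2, h3⟩ := ih
      by_cases h : d + 1 ≤ u.length
      · exact ⟨u, hu, h, by omega, h3⟩
      · obtain ⟨v, hv, hv0, hv1, hv2⟩ := hR (a + u.length)
        have := List.length_pos_iff.2 hv0
        exact ⟨u ++ v, σ.append_mem u hu v hv, by rw [List.length_append]; omega,
          by rw [List.length_append]; omega, h3.append hv2⟩
  obtain ⟨u, hu, hu0, -, hus⟩ := hR σ.w.length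
  set w' := σ.w ++ u with hw'
  have hw'M : w' ∈ σ.M := σ.append_mem _ σ.w_mem _ hu
  obtain ⟨N, hN⟩ := hA (R + w'.length)
  set G : Set (List Bool) := {g | w' <:+ g ∧ g.length ≤ N + R + w'.length} with hG
  refine ⟨⟨w', σ.M ∩ concatenations G, ⟨σ.nil_mem, nil_mem_concatenations G⟩,
    fun u hu v hv => ⟨σ.append_mem u hu.1 v hv.1, append_mem_concatenations hu.2 hv.2⟩,
    ⟨hw'M, subset_concatenations G ⟨List.suffix_refl _, by omega⟩⟩,
    σ.sits.append (by simpa using hus), N + R + w'.length, fun a => ?_⟩,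
    List.prefix_append _ _, ?_, inter_subset_left, N + R + w'.length, inter_subset_right⟩
  · obtain ⟨n, hn1, hn2, hn3⟩ := hN a
    obtain ⟨v, hv, hv1, hv2, hv3⟩ := reach a (n - a)
    have hlen : (v ++ w').length ≤ N + R + w'.length := by rw [List.length_append]; omega
    refine ⟨v ++ w', ⟨σ.append_mem v hv _ hw'M,
      subset_concatenations G ⟨List.suffix_append _ _, hlen⟩⟩, ?_, hlen, hv3.append ?_⟩
    · simp [hw', hu0]
    · intro i hi
      have hi' := (List.getElem?_eq_some_iff.1 hi).1
      have := hn3 (a + v.length + i - n) (by omega)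
      rwa [show n + (a + v.length + i - n) = a + v.length + i by omega] at this
  · have := List.length_pos_iff.2 hu0
    simp only [hw', List.length_append]
    omega

/-- Every thickly syndetic set contains the support of a nonzero uniformly recurrent sequence. -/
theorem ThicklySyndetic.exists_uniformlyRecurrent {A : Set ℕ} (hA : ThicklySyndetic A) :
    ∃ y : ℕ → Bool, (∃ t, y t = true) ∧ (∀ n, y n = true → n ∈ A) ∧
      ∀ k, ∃ G : ℕ, ∀ i, ∃ j ≤ G, ∀ r < k, y (i + j + r) = y r := by
  obtain ⟨t, ht⟩ : ∃ t, t ∈ A := by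
    obtain ⟨N, hN⟩ := hA 0
    obtain ⟨n, -, -, h⟩ := hN 0
    exact ⟨n, h 0 le_rfl⟩
  have sits_replicate : ∀ k a : ℕ, SitsIn A (List.replicate k false) a := by
    intro k a i hi
    simp [List.getElem?_replicate] at hi
  let σ₀ : RecurrenceStage A :=
    ⟨List.replicate t false ++ [true], univ, trivial, fun _ _ _ _ => trivial, trivial,
      (sits_replicate t 0).append fun i hi => by
        have := (List.getElem?_eq_some_iff.1 hi).1
        simp at this
        simpa [this] using ht,
      1, fun a => ⟨[false], trivial, by simp, by simp, sits_replicate 1 a⟩⟩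
  choose next hpre hlt hM hR using fun σ : RecurrenceStage A => σ.exists_next hA
  let σ : ℕ → RecurrenceStage A := fun n => next^[n] σ₀
  have hσ : ∀ n, σ (n + 1) = next (σ n) := fun n => Function.iterate_succ_apply' _ _ _
  have hlen : ∀ n, n < (σ n).w.length := by
    intro n
    induction n with
    | zero => simp [σ, σ₀]
    | succ n ih => rw [hσ]; have := hlt (σ n); omega
  have hmono : ∀ m n, m ≤ n → (σ m).w <+: (σ n).w ∧ (σ n).M ⊆ (σ m).M := by
    intro m n h
    induction n, h using Nat.le_induction with
    | base => exact ⟨List.prefix_refl _, Subset.rfl⟩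
    | succ n _ ih => rw [hσ]; exact ⟨ih.1.trans (hpre _), (hM _).trans ih.2⟩
  have hpre_get : ∀ m n i, m ≤ n → i < (σ m).w.length → (σ n).w[i]? = (σ m).w[i]? := by
    intro m n i h hi
    obtain ⟨v, hv⟩ := (hmono m n h).1
    rw [← hv, List.getElem?_append_left hi]
  let y : ℕ → Bool := fun n => (σ n).w[n]'(hlen n)
  have hy : ∀ m i, i < (σ m).w.length → (σ m).w[i]? = some (y i) := by
    intro m i hi
    have h : (σ i).w[i]? = some (y i) := List.getElem?_eq_getElem (hlen i)
    rcases le_total m i with hmi | him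
    · rw [← hpre_get m i i hmi hi, h]
    · rw [hpre_get i m i him (hlen i), h]
  refine ⟨y, ⟨t, ?_⟩, fun n hn => ?_, fun k => ?_⟩
  · have := hy 0 t (by simp [σ, σ₀])
    simpa [σ, σ₀] using this.symm
  · have := (σ n).sits n (by rw [hy n n (hlen n), hn])
    simpa using this
  · obtain ⟨R, hR⟩ := hR (σ k)
    rw [← hσ] at hR
    refine ⟨2 * R, fun i => ?_⟩
    set m := i + (σ (k + 1)).w.length + k + 1 with hm
    have hlm := hlen m
    obtain ⟨j, hj, h⟩ := exists_occursAt_of_add_le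
      (hR ((hmono (k + 1) m (by omega)).2 (σ m).w_mem)) i (by omega)
    refine ⟨j, hj, fun r hr => ?_⟩
    have hr' : r < (σ (k + 1)).w.length := by have := hlen (k + 1); omega
    have h1 := h r hr'
    rw [hy _ r hr'] at h1
    have h2 := (List.getElem?_eq_some_iff.1 h1).1
    rw [hy _ _ h2] at h1
    exact Option.some.inj h1

theorem self_mem_orbit {X : Type*} (T : X → X) (x : X) : x ∈ orbit T x := ⟨0, rfl⟩

theorem iterate_mem_orbit {X : Type*} (T : X → X) (x : X) (n : ℕ) : T^[n] x ∈ orbit T x :=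
  ⟨n, rfl⟩

theorem orbit_iterate_subset {X : Type*} (T : X → X) (x : X) (k : ℕ) :
    orbit T (T^[k] x) ⊆ orbit T x := by
  rintro _ ⟨n, rfl⟩
  exact ⟨n + k, Function.iterate_add_apply T n k x⟩

theorem orbit_subset_of_mapsTo {X : Type*} {T : X → X} {K : Set X} (hK : MapsTo T K K) {x : X}
    (hx : x ∈ K) : orbit T x ⊆ K := by
  rintro _ ⟨n, rfl⟩
  exact hK.iterate n hx

theorem mapsTo_closure_orbit {X : Type*} [TopologicalSpace X] {T : X → X} (hT : Continuous T)
    (x : X) : MapsTo T (closure (orbit T x)) (closure (orbit T x)) := by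
  refine MapsTo.closure ?_ hT
  rintro _ ⟨n, rfl⟩
  exact ⟨n + 1, Function.iterate_succ_apply' T n x⟩

theorem closure_orbit_subset {X : Type*} [TopologicalSpace X] {T : X → X} (hT : Continuous T)
    {x y : X} (hy : y ∈ closure (orbit T x)) : closure (orbit T y) ⊆ closure (orbit T x) :=
  closure_minimal (orbit_subset_of_mapsTo (mapsTo_closure_orbit hT x) hy) isClosed_closure

theorem exists_iterate_mem_of_mem_closure_orbit {X : Type*} [TopologicalSpace X] {T : X → X}
    {x y : X} (hy : y ∈ closure (orbit T x)) {U : Set X} (hU : IsOpen U) (hyU : y ∈ U) :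
    ∃ n, T^[n] x ∈ U := by
  obtain ⟨_, h, n, rfl⟩ := mem_closure_iff.1 hy U hU hyU
  exact ⟨n, h⟩

theorem prod_iterate {X Y : Type*} (T : X → X) (S : Y → Y) (n : ℕ) (p : X × Y) :
    (fun p : X × Y => (T p.1, S p.2))^[n] p = (T^[n] p.1, S^[n] p.2) := by
  induction n generalizing p with
  | zero => rfl
  | succ n ih => rw [Function.iterate_succ_apply, ih]; rfl

namespace IsMinimalPoint

variable {X : Type*} [TopologicalSpace X] {T : X → X} {x y : X}

theorem of_mem_closure (hT : Continuous T) (hx : IsMinimalPoint T x)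
    (hy : y ∈ closure (orbit T x)) : IsMinimalPoint T y := fun z hz =>
  (closure_orbit_subset hT hy).trans (hx z (closure_orbit_subset hT hy hz))

theorem iterate (hT : Continuous T) (hx : IsMinimalPoint T x) (k : ℕ) :
    IsMinimalPoint T (T^[k] x) :=
  hx.of_mem_closure hT (subset_closure (iterate_mem_orbit T x k))

theorem closure_orbit_iterate (hT : Continuous T) (hx : IsMinimalPoint T x) (k : ℕ) :
    closure (orbit T (T^[k] x)) = closure (orbit T x) :=
  have h := subset_closure (iterate_mem_orbit T x k)
  (closure_orbit_subset hT h).antisymm (hx _ h)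

/-- A point returning syndetically often to each of its neighbourhoods is minimal. -/
theorem of_syndetic [RegularSpace X] (hT : Continuous T)
    (h : ∀ V ∈ 𝓝 x, Syndetic {n | T^[n] x ∈ V}) : IsMinimalPoint T x := by
  intro y hy
  suffices hx : x ∈ closure (orbit T y) from closure_orbit_subset hT hx
  rw [mem_closure_iff_nhds]
  intro V hV
  obtain ⟨C, hC, hCc, hCV⟩ := exists_mem_nhds_isClosed_subset hV
  obtain ⟨N, hN⟩ := h C hC
  have hcl : IsClosed (⋃ j ∈ Finset.range (N + 1), T^[j] ⁻¹' C) :=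
    isClosed_biUnion_finset fun j _ => hCc.preimage (hT.iterate j)
  have hsub : orbit T x ⊆ ⋃ j ∈ Finset.range (N + 1), T^[j] ⁻¹' C := by
    rintro _ ⟨i, rfl⟩
    obtain ⟨j, hj, hij⟩ := hN i
    simp only [mem_iUnion, Finset.mem_range, mem_preimage]
    refine ⟨j, by omega, ?_⟩
    rw [← Function.iterate_add_apply, add_comm]
    exact hij
  have := closure_minimal hsub hcl hy
  simp only [mem_iUnion, Finset.mem_range, mem_preimage] at this
  obtain ⟨j, -, hj⟩ := this
  exact ⟨_, hCV hj, iterate_mem_orbit T y j⟩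

end IsMinimalPoint

theorem exists_isMinimalPoint {X : Type*} [TopologicalSpace X] [CompactSpace X] {T : X → X}
    (hT : Continuous T) (x : X) : ∃ y ∈ closure (orbit T x), IsMinimalPoint T y := by
  obtain ⟨m, hmx, hm⟩ := zorn_superset_nonempty
    {K : Set X | K.Nonempty ∧ IsClosed K ∧ MapsTo T K K} (fun c hc hchain hne => by
      have : Nonempty c := hne.to_subtype
      refine ⟨⋂₀ c, ⟨?_, isClosed_sInter fun K hK => (hc hK).2.1, fun y hy K hK =>
        (hc hK).2.2 (hy K hK)⟩, fun K hK => sInter_subset_of_mem hK⟩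
      exact IsCompact.nonempty_sInter_of_directed_nonempty_isCompact_isClosed
        (fun K hK K' hK' => (hchain.total hK hK').elim (fun h => ⟨K, hK, Subset.rfl, h⟩)
          fun h => ⟨K', hK', h, Subset.rfl⟩) (fun K hK => (hc hK).1)
        (fun K hK => (hc hK).2.1.isCompact) (fun K hK => (hc hK).2.1))
    (closure (orbit T x)) ⟨⟨x, subset_closure (self_mem_orbit T x)⟩, isClosed_closure,
      mapsTo_closure_orbit hT x⟩
  obtain ⟨⟨y, hy⟩, hmc, hmT⟩ := hm.prop
  have key : ∀ z ∈ m, closure (orbit T z) ⊆ m := fun z hz =>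
    closure_minimal (orbit_subset_of_mapsTo hmT hz) hmc
  refine ⟨y, hmx hy, fun z hz => (key y hy).trans ?_⟩
  exact hm.le_of_le ⟨⟨z, subset_closure (self_mem_orbit T z)⟩, isClosed_closure,
    mapsTo_closure_orbit hT z⟩ (key z (key y hy hz))

theorem exists_uniform_hitting_time {X : Type*} [TopologicalSpace X] {T : X → X}
    (hT : Continuous T) {K O : Set X} (hK : IsCompact K) (hO : IsOpen O)
    (h : ∀ x ∈ K, ∃ n, T^[n] x ∈ O) : ∃ N, ∀ x ∈ K, ∃ n ≤ N, T^[n] x ∈ O := by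
  obtain ⟨N, hN⟩ := hK.elim_directed_cover (fun N : ℕ => ⋃ n ≤ N, T^[n] ⁻¹' O)
    (fun N => isOpen_biUnion fun n _ => hO.preimage (hT.iterate n))
    (fun x hx => by
      obtain ⟨n, hn⟩ := h x hx
      exact mem_iUnion.2 ⟨n, mem_biUnion (le_refl n) hn⟩)
    (directed_of_isDirected_le fun M N hMN => biUnion_subset_biUnion_left fun n hn =>
      le_trans hn hMN)
  exact ⟨N, fun x hx => by simpa using hN hx⟩

/-- The set of times at which a point avoids an open set with no minimal point in its closure
is thickly syndetic. -/
theorem thicklySyndetic_of_forall_not_isMinimalPoint {X : Type*} [TopologicalSpace X]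
    [CompactSpace X] {T : X → X} (hT : Continuous T) {U : Set X}
    (hU : ∀ x ∈ closure U, ¬ IsMinimalPoint T x) (x : X) :
    ThicklySyndetic {n | T^[n] x ∉ U} := by
  intro L
  have hO : IsOpen (⋂ j ∈ Finset.range (L + 1), T^[j] ⁻¹' (closure U)ᶜ) :=
    isOpen_biInter_finset fun j _ => isClosed_closure.isOpen_compl.preimage (hT.iterate j)
  obtain ⟨N, hN⟩ := exists_uniform_hitting_time hT isCompact_univ hO fun z _ => by
    obtain ⟨y, hyz, hy⟩ := exists_isMinimalPoint hT z
    refine exists_iterate_mem_of_mem_closure_orbit hyz hO ?_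
    simp only [mem_iInter, mem_preimage, mem_compl_iff]
    exact fun j _ h => hU _ h (hy.iterate hT j)
  refine ⟨N, fun a => ?_⟩
  obtain ⟨n, hn, h⟩ := hN (T^[a] x) trivial
  refine ⟨a + n, by omega, by omega, fun j hj hmem => ?_⟩
  simp only [mem_iInter, mem_preimage, mem_compl_iff, Finset.mem_range] at h
  refine h j (by omega) (subset_closure ?_)
  rw [← Function.iterate_add_apply, ← Function.iterate_add_apply,
    show j + n + a = a + n + j by omega]
  exact hmem

theorem IsMinimalSys.surjective {Y : Type*} [TopologicalSpace Y] [CompactSpace Y] [T2Space Y]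
    {S : Y → Y} (hS : Continuous S) (h : IsMinimalSys S) : Function.Surjective S := by
  rw [← range_eq_univ, ← (isCompact_range hS).isClosed.closure_eq]
  refine eq_univ_of_forall fun y => ?_
  refine closure_mono ?_ (h (S y) y)
  rintro _ ⟨n, rfl⟩
  exact ⟨S^[n] y, (Function.iterate_succ_apply' S n y).symm.trans
    (Function.iterate_succ_apply S n y)⟩

/-- The minimal system carried by the orbit closure of a minimal point. -/
theorem IsMinimalPoint.isMinimalSys_restrict {X : Type*} [TopologicalSpace X] {T : X → X} {x : X}
    (hT : Continuous T) (hx : IsMinimalPoint T x) :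
    IsMinimalSys ((mapsTo_closure_orbit hT x).restrict) := by
  intro y z
  rw [closure_subtype]
  have hz : (z : X) ∈ closure (orbit T y) := hx y y.2 z.2
  refine closure_mono ?_ hz
  rintro _ ⟨n, rfl⟩
  refine ⟨_, ⟨n, rfl⟩, ?_⟩
  simp only
  rw [MapsTo.iterate_restrict]
  rfl

/-- The system is disjoint from every minimal system. -/
def DisjointFromMinimal {X : Type} [TopologicalSpace X] (T : X → X) : Prop :=
  ∀ 𝒴 : TDS, IsMinimalSys 𝒴.map → DisjointSys T 𝒴.map

/-- If a system is disjoint from all minimal systems, then a point with dense orbit paired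
with a minimal point of another system moves densely in the product. -/
theorem DisjointFromMinimal.exists_iterate_mem {X : Type} [TopologicalSpace X] [CompactSpace X]
    [T2Space X] {T : X → X} (hT : Continuous T) (hdis : DisjointFromMinimal T) {x : X}
    (hx : Dense (orbit T x)) {Z : Type} [t : TopologicalSpace Z] [CompactSpace Z]
    [TopologicalSpace.MetrizableSpace Z] {S : Z → Z} (hS : Continuous S) {z : Z}
    (hz : IsMinimalPoint S z) {U : Set X} {V : Set Z} (hU : IsOpen U) (hV : IsOpen V)
    (hUne : U.Nonempty) (hVne : (V ∩ closure (orbit S z)).Nonempty) :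
    ∃ n, T^[n] x ∈ U ∧ S^[n] z ∈ V := by
  obtain ⟨m, hm⟩ : ∃ m : MetricSpace Z, m.toUniformSpace.toTopologicalSpace = t :=
    ⟨TopologicalSpace.metrizableSpaceMetric Z, rfl⟩
  subst hm
  have hmaps := mapsTo_closure_orbit hS z
  have hmin := hz.isMinimalSys_restrict hS
  have hcpt : CompactSpace (closure (orbit S z)) :=
    isCompact_iff_compactSpace.1 isClosed_closure.isCompact
  have hcont : Continuous hmaps.restrict := hS.restrict hmaps
  set S' := hmaps.restrict with hS'
  let z' : closure (orbit S z) := ⟨z, subset_closure (self_mem_orbit S z)⟩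
  let P : X × closure (orbit S z) → X × closure (orbit S z) := fun p => (T p.1, S' p.2)
  have hP : Continuous P := by fun_prop
  set J := closure (orbit P (x, z')) with hJ
  have hJc : IsCompact J := isClosed_closure.isCompact
  have hJu : J = univ := by
    refine hdis ⟨closure (orbit S z), S', hcont, hmin.surjective hcont⟩ hmin J
      ⟨⟨_, subset_closure (self_mem_orbit P _)⟩, isClosed_closure, mapsTo_closure_orbit hP _,
        ?_, ?_⟩
    · rw [← (hJc.image continuous_fst).isClosed.closure_eq]
      refine (hx.mono ?_).closure_eq
      rintro _ ⟨n, rfl⟩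
      exact ⟨_, subset_closure (iterate_mem_orbit P _ n), by rw [prod_iterate]⟩
    · rw [← (hJc.image continuous_snd).isClosed.closure_eq]
      refine ((hmin z').mono ?_).closure_eq
      rintro _ ⟨n, rfl⟩
      exact ⟨_, subset_closure (iterate_mem_orbit P _ n), by rw [prod_iterate]⟩
  obtain ⟨u, hu⟩ := hUne
  obtain ⟨v, hv, hvz⟩ := hVne
  have huv : (u, (⟨v, hvz⟩ : closure (orbit S z))) ∈ J := hJu ▸ mem_univ _
  obtain ⟨n, hn⟩ := exists_iterate_mem_of_mem_closure_orbit huv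
    (hU.prod (hV.preimage continuous_subtype_val)) ⟨hu, hv⟩
  rw [prod_iterate] at hn
  refine ⟨n, hn.1, ?_⟩
  have := hn.2
  rw [hS', MapsTo.iterate_restrict] at this
  exact this

theorem IsTransitiveSys.exists_dense_orbit {X : Type*} [TopologicalSpace X] [CompactSpace X]
    [T2Space X] [SecondCountableTopology X] [Nonempty X] {T : X → X} (hT : Continuous T)
    (h : IsTransitiveSys T) : ∃ x, Dense (orbit T x) := by
  let b := TopologicalSpace.countableBasis X
  have hd : Dense (⋂ V ∈ b, ⋃ n : ℕ, T^[n] ⁻¹' V) := by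
    refine dense_biInter_of_isOpen (fun V hV => isOpen_iUnion fun n =>
      (TopologicalSpace.isOpen_of_mem_countableBasis hV).preimage (hT.iterate n))
      (TopologicalSpace.countable_countableBasis X) fun V hV => ?_
    rw [dense_iff_inter_open]
    intro U hU hUne
    obtain ⟨n, x, hxU, hxV⟩ := (h U V hU (TopologicalSpace.isOpen_of_mem_countableBasis hV) hUne
      (TopologicalSpace.nonempty_of_mem_countableBasis hV)).nonempty
    exact ⟨x, hxU, mem_iUnion.2 ⟨n, hxV⟩⟩
  obtain ⟨x, hx⟩ := hd.nonempty
  refine ⟨x, (TopologicalSpace.isBasis_countableBasis X).dense_iff.2 fun V hV _ => ?_⟩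
  obtain ⟨n, hn⟩ := mem_iUnion.1 (mem_iInter₂.1 hx V hV)
  exact ⟨_, hn, iterate_mem_orbit T x n⟩

theorem Dense.orbit_iterate {X : Type*} [TopologicalSpace X] {T : X → X} (hT : Continuous T)
    (hTs : Function.Surjective T) {x : X} (hx : Dense (orbit T x)) (k : ℕ) :
    Dense (orbit T (T^[k] x)) := by
  have h := (hTs.iterate k).denseRange.comp hx (hT.iterate k)
  refine Dense.mono ?_ h
  rintro _ ⟨n, rfl⟩
  exact ⟨n, by simp only [Function.comp_apply, ← Function.iterate_add_apply, add_comm]⟩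

theorem shift_iterate_apply (n : ℕ) (z : ℕ → Bool) (r : ℕ) :
    (fun (z : ℕ → Bool) n => z (n + 1))^[n] z r = z (n + r) := by
  induction n generalizing z with
  | zero => simp
  | succ n ih =>
    rw [Function.iterate_succ_apply, ih]
    congr 1
    omega

theorem isMinimalPoint_shift {y : ℕ → Bool}
    (hy : ∀ k, ∃ G : ℕ, ∀ i, ∃ j ≤ G, ∀ r < k, y (i + j + r) = y r) :
    IsMinimalPoint (fun (z : ℕ → Bool) n => z (n + 1)) y := by
  refine IsMinimalPoint.of_syndetic (by fun_prop) fun V hV => ?_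
  rw [nhds_pi, Filter.mem_pi] at hV
  obtain ⟨I, hI, t, ht, htV⟩ := hV
  obtain ⟨k, hk⟩ := hI.bddAbove
  obtain ⟨G, hG⟩ := hy (k + 1)
  refine ⟨G, fun i => ?_⟩
  obtain ⟨j, hj, h⟩ := hG i
  refine ⟨j, hj, htV fun r hr => ?_⟩
  rw [shift_iterate_apply, h r (Nat.lt_succ_of_le (hk hr))]
  exact mem_of_mem_nhds (ht r)

theorem DisjointFromMinimal.dense_isMinimalPoint {X : Type} [TopologicalSpace X] [CompactSpace X]
    [T2Space X] {T : X → X} (hT : Continuous T) (hdis : DisjointFromMinimal T) {x : X}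
    (hx : Dense (orbit T x)) : Dense {y | IsMinimalPoint T y} := by
  by_contra hnd
  obtain ⟨x₀, hx₀⟩ : ∃ x₀, x₀ ∉ closure {y | IsMinimalPoint T y} := by
    simpa [Dense] using hnd
  obtain ⟨C, hC, hCc, hCs⟩ := exists_mem_nhds_isClosed_subset
    (isClosed_closure.isOpen_compl.mem_nhds hx₀)
  have hUC : closure (interior C) ⊆ C := closure_minimal interior_subset hCc
  obtain ⟨y, ⟨t, ht⟩, hyA, hy⟩ := (thicklySyndetic_of_forall_not_isMinimalPoint hT
    (U := interior C) (fun z hz hzm => hCs (hUC hz) (subset_closure hzm))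
    x).exists_uniformlyRecurrent
  have hV : IsOpen {z : ℕ → Bool | z 0 = true} :=
    (isOpen_discrete {true}).preimage (continuous_apply (A := fun _ : ℕ => Bool) 0)
  obtain ⟨n, hn1, hn2⟩ := hdis.exists_iterate_mem hT hx (by fun_prop) (isMinimalPoint_shift hy)
    isOpen_interior hV ⟨x₀, mem_interior_iff_mem_nhds.2 hC⟩
    ⟨_, (shift_iterate_apply t y 0).trans ht, subset_closure (iterate_mem_orbit _ y t)⟩
  exact hyA n ((shift_iterate_apply n y 0).symm.trans hn2) hn1

theorem DisjointFromMinimal.isWeaklyMixingSys {X : Type} [TopologicalSpace X] [CompactSpace X]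
    [TopologicalSpace.MetrizableSpace X] {T : X → X} (hT : Continuous T)
    (hTs : Function.Surjective T) (hTtr : IsTransitiveSys T) (hdis : DisjointFromMinimal T) {x : X}
    (hx : Dense (orbit T x)) : IsWeaklyMixingSys T := by
  intro U V hU hV ⟨u, hu⟩ ⟨v, hv⟩
  obtain ⟨U₁, U₂, hU₁, hU₂, hu₁, hu₂, hUU⟩ := isOpen_prod_iff.1 hU u.1 u.2 hu
  obtain ⟨V₁, V₂, hV₁, hV₂, hv₁, hv₂, hVV⟩ := isOpen_prod_iff.1 hV v.1 v.2 hv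
  obtain ⟨k, q, hq⟩ := (hTtr U₂ V₂ hU₂ hV₂ ⟨_, hu₂⟩ ⟨_, hv₂⟩).nonempty
  have hW : IsOpen (U₂ ∩ T^[k] ⁻¹' V₂) := hU₂.inter (hV₂.preimage (hT.iterate k))
  obtain ⟨w, hwW, hw⟩ := (hdis.dense_isMinimalPoint hT hx).inter_open_nonempty _ hW ⟨q, hq⟩
  obtain ⟨q₁, hq₁⟩ := hTs.iterate k v.1
  refine infinite_of_not_bddAbove fun ⟨K, hK⟩ => ?_
  obtain ⟨a, ha₁, ha₂⟩ := hdis.exists_iterate_mem hT hx hT hw hU₁ hW ⟨_, hu₁⟩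
    ⟨w, hwW, subset_closure (self_mem_orbit T w)⟩
  obtain ⟨b, hb₁, hb₂⟩ := hdis.exists_iterate_mem hT (hx.orbit_iterate hT hTs (K + 1 + a)) hT
    (hw.iterate hT (K + 1 + a)) (hV₁.preimage (hT.iterate k)) hW
    ⟨q₁, by rwa [mem_preimage, hq₁]⟩
    ⟨w, hwW, by
      rw [hw.closure_orbit_iterate hT]
      exact subset_closure (self_mem_orbit T w)⟩
  have hmem : k + b + (K + 1) ∈
      {n | (U ∩ (fun p : X × X => (T p.1, T p.2))^[n] ⁻¹' V).Nonempty} := by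
    refine ⟨(T^[a] x, T^[a] w), hUU ⟨ha₁, ha₂.1⟩, ?_⟩
    rw [mem_preimage, prod_iterate]
    refine hVV ⟨?_, ?_⟩
    · simpa only [mem_preimage, ← Function.iterate_add_apply, add_assoc] using hb₁
    · simpa only [mem_preimage, ← Function.iterate_add_apply, add_assoc] using hb₂.2
  have := hK hmem
  omega

theorem DisjointFromMinimal.exists_countable_dense {X : Type} [MetricSpace X] [CompactSpace X]
    {T : X → X} (hT : Continuous T) (hdis : DisjointFromMinimal T) {x : X}
    (hx : Dense (orbit T x)) :
    ∃ D : Set X, D.Countable ∧ Dense D ∧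
      ∀ U : Set X, IsOpen U → U.Nonempty →
        ∀ B : Set ℕ, DynSyndetic B →
          ∃ x ∈ D ∩ U, ∀ A : Set ℕ, Thick A → ({n : ℕ | T^[n] x ∈ U} ∩ (A ∩ B)).Nonempty := by
  obtain ⟨D₀, hD₀m, hD₀c, hD₀⟩ := (hdis.dense_isMinimalPoint hT hx).exists_countable_dense_subset
  refine ⟨⋃ k : ℕ, T^[k] '' D₀, countable_iUnion fun k => hD₀c.image _,
    hD₀.mono fun z hz => mem_iUnion.2 ⟨0, z, hz, rfl⟩, ?_⟩
  rintro U hU ⟨u, hu⟩ B ⟨𝒴, hmin, y, V, hV, hy, hB⟩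
  let P : X × 𝒴.carrier → X × 𝒴.carrier := fun p => (T p.1, 𝒴.map p.2)
  have hP : Continuous P := (hT.comp continuous_fst).prodMk (𝒴.cont.comp continuous_snd)
  have hUV : IsOpen (U ×ˢ V) := hU.prod hV
  set J : Set (X × 𝒴.carrier) := {p | ∀ n, P^[n] p ∉ U ×ˢ V} with hJ
  have hJc : IsClosed J := by
    rw [hJ, ofPred_forall]
    exact isClosed_iInter fun n => (hUV.preimage (hP.iterate n)).isClosed_compl
  have hJP : MapsTo P J J := fun p hp n => by
    rw [← Function.iterate_succ_apply]
    exact hp (n + 1)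
  have hfst : IsClosed (Prod.fst '' J) := (hJc.isCompact.image continuous_fst).isClosed
  have hfstT : MapsTo T (Prod.fst '' J) (Prod.fst '' J) := by
    rintro _ ⟨p, hp, rfl⟩
    exact ⟨P p, hJP hp, rfl⟩
  have hne : (Prod.fst '' J)ᶜ.Nonempty := by
    rw [nonempty_compl]
    intro h
    have hJu : J = univ := by
      refine hdis 𝒴 hmin J ⟨?_, hJc, fun p hp => hJP hp, h, ?_⟩
      · obtain ⟨p, hp, -⟩ := h.symm ▸ mem_univ u
        exact ⟨p, hp⟩
      · obtain ⟨p, hp, -⟩ := h.symm ▸ mem_univ u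
        rw [← (hJc.isCompact.image continuous_snd).isClosed.closure_eq]
        have hmaps : MapsTo 𝒴.map (Prod.snd '' J) (Prod.snd '' J) := by
          rintro _ ⟨p, hp, rfl⟩
          exact ⟨P p, hJP hp, rfl⟩
        exact ((hmin p.2).mono (orbit_subset_of_mapsTo hmaps (mem_image_of_mem _ hp))).closure_eq
    exact (hJu ▸ mem_univ (u, y) : (u, y) ∈ J) 0 ⟨hu, hy⟩
  obtain ⟨x₀, hx₀J, hx₀⟩ := hD₀.inter_open_nonempty _ hfst.isOpen_compl hne
  have hdisj : ∀ z ∈ closure (orbit T x₀), z ∉ Prod.fst '' J := fun z hz hzJ =>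
    hx₀J (closure_minimal (orbit_subset_of_mapsTo hfstT hzJ) hfst
      (hD₀m hx₀ z hz (subset_closure (self_mem_orbit T x₀))))
  obtain ⟨N, hN⟩ := exists_uniform_hitting_time hP
    (isClosed_closure.prod isClosed_univ : IsClosed (closure (orbit T x₀) ×ˢ
      (univ : Set 𝒴.carrier))).isCompact hUV fun p hp => by
    by_contra! h
    exact hdisj p.1 hp.1 ⟨p, h, rfl⟩
  obtain ⟨k, -, hk⟩ := hN (x₀, y) ⟨subset_closure (self_mem_orbit T x₀), trivial⟩
  rw [prod_iterate] at hk
  refine ⟨T^[k] x₀, ⟨mem_iUnion.2 ⟨k, x₀, hx₀, rfl⟩, hk.1⟩, fun A hA => ?_⟩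
  obtain ⟨a, ha⟩ := hA N
  obtain ⟨n, hn, hmem⟩ := hN (T^[a] (T^[k] x₀), 𝒴.map^[a] y)
    ⟨subset_closure (orbit_iterate_subset T x₀ k (iterate_mem_orbit T _ a)), trivial⟩
  rw [prod_iterate] at hmem
  simp only [← Function.iterate_add_apply] at hmem
  refine ⟨a + n, ?_, ha n hn, hB ?_⟩
  · have := hmem.1
    rw [show n + (a + k) = a + n + k by omega, Function.iterate_add_apply] at this
    exact this
  · rw [add_comm]
    exact hmem.2

/-- Furstenberg's intersection lemma for a common source. -/
theorem IsWeaklyMixingSys.exists_inter {X : Type*} [TopologicalSpace X] {T : X → X}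
    (hT : Continuous T) (h : IsWeaklyMixingSys T) {W : Set X} (hW : IsOpen W) (hWne : W.Nonempty)
    {𝒱 : Set (Set X)} (h𝒱 : 𝒱.Finite) (hV : ∀ V ∈ 𝒱, IsOpen V ∧ V.Nonempty) :
    ∃ W' V' : Set X, (IsOpen W' ∧ W'.Nonempty) ∧ (IsOpen V' ∧ V'.Nonempty) ∧
      ∀ n, (W' ∩ T^[n] ⁻¹' V').Nonempty → ∀ V ∈ 𝒱, (W ∩ T^[n] ⁻¹' V).Nonempty := by
  induction 𝒱, h𝒱 using Set.Finite.induction_on with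
  | empty => exact ⟨W, W, ⟨hW, hWne⟩, ⟨hW, hWne⟩, by simp⟩
  | @insert V 𝒱 _ _ ih =>
    obtain ⟨W', V', ⟨hW'o, hW'⟩, ⟨hV'o, hV'⟩, hWV⟩ := ih fun V hV' => hV V (mem_insert_of_mem _ hV')
    obtain ⟨hVo, hVne⟩ := hV V (mem_insert _ _)
    obtain ⟨n, p, ⟨hp₁, hp₂⟩, hpn⟩ := (h (W' ×ˢ V') (W ×ˢ V) (hW'o.prod hV'o) (hW.prod hVo)
      (hW'.prod hV') (hWne.prod hVne)).nonempty
    rw [mem_preimage, prod_iterate] at hpn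
    refine ⟨W' ∩ T^[n] ⁻¹' W, V' ∩ T^[n] ⁻¹' V,
      ⟨hW'o.inter (hW.preimage (hT.iterate n)), p.1, hp₁, hpn.1⟩,
      ⟨hV'o.inter (hVo.preimage (hT.iterate n)), p.2, hp₂, hpn.2⟩, ?_⟩
    rintro m ⟨q, ⟨hq₁, hq₂⟩, hq₃, hq₄⟩ V₀ (rfl | hV₀)
    · refine ⟨T^[n] q, hq₂, ?_⟩
      rw [mem_preimage, ← Function.iterate_add_apply, add_comm, Function.iterate_add_apply]
      exact hq₄
    · exact hWV m ⟨q, hq₁, hq₃⟩ V₀ hV₀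

theorem IsWeaklyMixingSys.isTransitiveSys {X : Type*} [TopologicalSpace X] {T : X → X}
    (h : IsWeaklyMixingSys T) : IsTransitiveSys T := by
  intro U V hU hV hUne hVne
  refine (h (U ×ˢ U) (V ×ˢ V) (hU.prod hU) (hV.prod hV) (hUne.prod hUne) (hVne.prod hVne)).mono ?_
  rintro n ⟨p, hp, hpn⟩
  rw [mem_preimage, prod_iterate] at hpn
  exact ⟨p.1, hp.1, hpn.1⟩

/-- In a weakly mixing system, every iterate of a generic point is proximal, along intervals of
arbitrary length, to each point of a given countable set. -/
theorem IsWeaklyMixingSys.exists_shadowing {X : Type*} [MetricSpace X] [CompactSpace X] [Nonempty X]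
    {T : X → X} (hT : Continuous T) (h : IsWeaklyMixingSys T) {D : Set X} (hD : D.Countable) :
    ∃ z, ∀ x ∈ D, ∀ k : ℕ, ∀ ε > 0, Thick {n | dist (T^[n + k] z) (T^[n] x) < ε} := by
  have := hD.to_subtype
  let G : D × ℕ × ℕ × ℕ → Set X := fun i => ⋃ n : ℕ, ⋂ j ∈ Finset.range (i.2.2.2 + 1),
    {z | dist (T^[n + j + i.2.1] z) (T^[n + j] i.1) < 1 / ((i.2.2.1 : ℝ) + 1)}
  have hGo : ∀ i, IsOpen (G i) := fun i => isOpen_iUnion fun n => isOpen_biInter_finset fun j _ =>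
    isOpen_lt ((hT.iterate _).dist continuous_const) continuous_const
  have hGd : ∀ i, Dense (G i) := by
    rintro ⟨x, k, m, L⟩
    rw [dense_iff_inter_open]
    intro W hW hWne
    have hunif : {p : X × X | ∀ j ∈ Finset.range (L + 1),
        dist (T^[j] p.1) (T^[j] p.2) < 1 / ((m : ℝ) + 1)} ∈ uniformity X := by
      refine (Finset.eventually_all _).2 fun j _ => ?_
      exact CompactSpace.uniformContinuous_of_continuous (hT.iterate j)
        (Metric.dist_mem_uniformity (by positivity))
    obtain ⟨δ, hδ, hδm⟩ := Metric.mem_uniformity_dist.1 hunif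
    obtain ⟨c, -, hc, hcov⟩ := finite_cover_balls_of_compact (isCompact_univ (X := X)) (half_pos hδ)
    obtain ⟨W', V', ⟨hW'o, hW'⟩, ⟨hV'o, hV'⟩, hWV⟩ := h.exists_inter hT hW hWne
      (hc.image fun y => Metric.ball y (δ / 2)) (by
        rintro _ ⟨y, -, rfl⟩
        exact ⟨Metric.isOpen_ball, Metric.nonempty_ball.2 (half_pos hδ)⟩)
    obtain ⟨n, hn, hkn⟩ := (h.isTransitiveSys W' V' hW'o hV'o hW' hV').exists_gt k
    obtain ⟨y, hy, hxy⟩ := mem_iUnion₂.1 (hcov (mem_univ (T^[n - k] (x : X))))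
    obtain ⟨z, hzW, hz⟩ := hWV n hn _ ⟨y, hy, rfl⟩
    refine ⟨z, hzW, mem_iUnion.2 ⟨n - k, mem_iInter₂.2 fun j hj => ?_⟩⟩
    have hd : dist (T^[n] z) (T^[n - k] (x : X)) < δ := by
      have h1 : dist (T^[n] z) y < δ / 2 := hz
      have h2 : dist (T^[n - k] (x : X)) y < δ / 2 := hxy
      linarith [dist_triangle_right (T^[n] z) (T^[n - k] (x : X)) y]
    have := hδm hd j hj
    rw [← Function.iterate_add_apply, ← Function.iterate_add_apply] at this
    rw [mem_ofPred_eq, show n - k + j + k = j + n by omega, add_comm (n - k) j]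
    exact this
  obtain ⟨z, hz⟩ := (dense_iInter_of_isOpen hGo hGd).nonempty
  refine ⟨z, fun x hx k ε hε L => ?_⟩
  obtain ⟨m, hm⟩ := exists_nat_one_div_lt hε
  obtain ⟨n, hn⟩ := mem_iUnion.1 (mem_iInter.1 hz (⟨x, hx⟩, k, m, L))
  refine ⟨n, fun j hj => ?_⟩
  exact (mem_iInter₂.1 hn j (Finset.mem_range.2 (Nat.lt_succ_of_le hj))).trans hm

theorem disjointFromMinimal_of_isWeaklyMixingSys {X : Type} [MetricSpace X] [CompactSpace X]
    {T : X → X} (hT : Continuous T) (h : IsWeaklyMixingSys T) {D : Set X} (hDc : D.Countable)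
    (hD : ∀ U : Set X, IsOpen U → U.Nonempty → ∀ B : Set ℕ, DynSyndetic B →
      ∃ x ∈ D ∩ U, ∀ A : Set ℕ, Thick A → ({n : ℕ | T^[n] x ∈ U} ∩ (A ∩ B)).Nonempty) :
    DisjointFromMinimal T := by
  rintro 𝒴 hmin J ⟨⟨p, -⟩, hJc, hJP, hJ₁, -⟩
  have : Nonempty X := ⟨p.1⟩
  obtain ⟨z, hz⟩ := h.exists_shadowing hT hDc
  obtain ⟨y, hzy⟩ : ∃ y, (z, y) ∈ J := by
    obtain ⟨⟨_, y⟩, hzy, rfl⟩ : z ∈ Prod.fst '' J := hJ₁ ▸ mem_univ z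
    exact ⟨y, hzy⟩
  refine eq_univ_of_forall fun ⟨u, v⟩ => hJc.closure_eq ▸ mem_closure_iff.2 fun O hO huv => ?_
  obtain ⟨U, V, hU, hV, hu, hv, hUV⟩ := isOpen_prod_iff.1 hO u v huv
  obtain ⟨ε, hε, hεU⟩ := Metric.isOpen_iff.1 hU u hu
  obtain ⟨k, hk⟩ := exists_iterate_mem_of_mem_closure_orbit (hmin y v) hV hv
  obtain ⟨x, hx, hxA⟩ := hD (Metric.ball u (ε / 2)) Metric.isOpen_ball
    (Metric.nonempty_ball.2 (half_pos hε)) {n | 𝒴.map^[n] (𝒴.map^[k] y) ∈ V}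
    ⟨𝒴, hmin, 𝒴.map^[k] y, V, hV, hk, Subset.rfl⟩
  obtain ⟨n, hn₁, hn₂, hn₃⟩ := hxA _ (hz x hx.1 k (ε / 2) (half_pos hε))
  refine ⟨(T^[n + k] z, 𝒴.map^[n + k] y), hUV ⟨hεU ?_, ?_⟩, ?_⟩
  · have h1 : dist (T^[n] x) u < ε / 2 := hn₁
    have h2 : dist (T^[n + k] z) (T^[n] x) < ε / 2 := hn₂
    rw [Metric.mem_ball]
    linarith [dist_triangle (T^[n + k] z) (T^[n] x) u]
  · rwa [mem_ofPred_eq, ← Function.iterate_add_apply] at hn₃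
  · have := (show MapsTo (fun p : X × 𝒴.carrier => (T p.1, 𝒴.map p.2)) J J from
      fun p hp => hJP p hp).iterate (n + k) hzy
    rwa [prod_iterate] at this

theorem stmt_7 {X : Type} [MetricSpace X] [CompactSpace X] (T : X → X)
    (hTc : Continuous T) (hTs : Function.Surjective T) (hTtr : IsTransitiveSys T) :
    (∀ 𝒴 : TDS, IsMinimalSys 𝒴.map → DisjointSys T 𝒴.map) ↔
      (IsWeaklyMixingSys T ∧ ∃ D : Set X, D.Countable ∧ Dense D ∧
        ∀ U : Set X, IsOpen U → U.Nonempty →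
          ∀ B : Set ℕ, DynSyndetic B →
            ∃ x ∈ D ∩ U, ∀ A : Set ℕ, Thick A →
              ({n : ℕ | T^[n] x ∈ U} ∩ (A ∩ B)).Nonempty) := by
  constructor
  · intro hdis
    rcases isEmpty_or_nonempty X with hX | hX
    · exact ⟨fun U _ _ _ hU => (hX.false hU.some.1).elim,
        ∅, countable_empty, fun x => (hX.false x).elim, fun U _ hU => (hX.false hU.some).elim⟩
    · obtain ⟨x, hx⟩ := hTtr.exists_dense_orbit hTc
      exact ⟨DisjointFromMinimal.isWeaklyMixingSys hTc hTs hTtr hdis hx,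
        DisjointFromMinimal.exists_countable_dense hTc hdis hx⟩
  · rintro ⟨hwm, D, hDc, -, hD⟩
    exact disjointFromMinimal_of_isWeaklyMixingSys hTc hwm hDc hD
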